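/- Let s, t be distinct vertices and let L be a latest minimum (s,t)-cut side. Then L ⊆ A for every minimum (s,t)-cut side A. -/

import Mathlib

open Finset

variable {V : Type*}

/-- The cut value of a set `S`: total weight of pairs crossing `(S, Sᶜ)`. -/
def cutValue [Fintype V] [DecidableEq V] (w : V → V → ℝ) (S : Finset V) : ℝ :=
  ∑ x ∈ S, ∑ y ∈ Sᶜ, w x y

/-- `S` is an `(s,t)`-cut side if `s ∈ S` and `t ∉ S`. -/
def IsCutSide [Fintype V] [DecidableEq V] (s t : V) (S : Finset V) : Prop :=
  s ∈ S ∧ t ∉ S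

/-- `S` is a minimum `(s,t)`-cut side. -/
def IsMinCutSide [Fintype V] [DecidableEq V] (w : V → V → ℝ) (s t : V) (S : Finset V) : Prop :=
  IsCutSide s t S ∧ ∀ S' : Finset V, IsCutSide s t S' → cutValue w S ≤ cutValue w S'

/-- `S` is a latest minimum `(s,t)`-cut side: a minimum cut side of minimum cardinality
among all minimum cut sides. -/
def IsLatestMinCutSide [Fintype V] [DecidableEq V] (w : V → V → ℝ) (s t : V) (S : Finset V) : Prop :=
  IsMinCutSide w s t S ∧ ∀ S' : Finset V, IsMinCutSide w s t S' → S.card ≤ S'.card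

theorem cutValue_eq_sum_ite [Fintype V] [DecidableEq V] (w : V → V → ℝ) (S : Finset V) :
    cutValue w S = ∑ x, ∑ y, if x ∈ S ∧ y ∉ S then w x y else 0 := by
  simp [cutValue, ite_and, Finset.sum_ite, Finset.compl_eq_univ_sdiff, Finset.sdiff_eq_filter]

/-- The cut function is submodular. -/
theorem cutValue_inter_add_cutValue_union_le [Fintype V] [DecidableEq V] {w : V → V → ℝ}
    (hnonneg : ∀ x y, 0 ≤ w x y) (S T : Finset V) :
    cutValue w (S ∩ T) + cutValue w (S ∪ T) ≤ cutValue w S + cutValue w T := by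
  simp only [cutValue_eq_sum_ite, ← Finset.sum_add_distrib]
  refine Finset.sum_le_sum fun x _ => Finset.sum_le_sum fun y _ => ?_
  have := hnonneg x y
  by_cases hxS : x ∈ S <;> by_cases hxT : x ∈ T <;> by_cases hyS : y ∈ S <;>
    by_cases hyT : y ∈ T <;> simp [hxS, hxT, hyS, hyT, this]

/-- Minimum cut sides are closed under intersection. -/
theorem IsMinCutSide.inter [Fintype V] [DecidableEq V] {w : V → V → ℝ}
    (hnonneg : ∀ x y, 0 ≤ w x y) {s t : V} {S T : Finset V}
    (hS : IsMinCutSide w s t S) (hT : IsMinCutSide w s t T) :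
    IsMinCutSide w s t (S ∩ T) := by
  have hunion : IsCutSide s t (S ∪ T) :=
    ⟨Finset.mem_union_left _ hS.1.1, by simp [hS.1.2, hT.1.2]⟩
  refine ⟨⟨Finset.mem_inter.2 ⟨hS.1.1, hT.1.1⟩, by simp [hS.1.2]⟩, fun S' hS' => ?_⟩
  linarith [cutValue_inter_add_cutValue_union_le hnonneg S T, hT.2 _ hunion, hS.2 S' hS']

theorem latest_min_cut_subset [Fintype V] [DecidableEq V] [Nonempty V] (w : V → V → ℝ)
    (hsymm : ∀ x y, w x y = w y x) (hnonneg : ∀ x y, 0 ≤ w x y)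
    (hzero : ∀ x, w x x = 0)
    (s t : V) (hst : s ≠ t)
    (L : Finset V) (hL : IsLatestMinCutSide w s t L)
    (A : Finset V) (hA : IsMinCutSide w s t A) :
    L ⊆ A := by
  exact Finset.inter_eq_left.1 <| Finset.eq_of_subset_of_card_le Finset.inter_subset_left <|
    hL.2 _ (hL.1.inter hnonneg hA)
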